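/- Let π be a schedule, p⁰ ∈ S a scenario, and f a machine that is critical for π under p⁰. Then machine f is also critical for π under the extreme scenario s^f of π for machine f, i.e., F_f(π, s^f) = F(π, s^f). -/

import Mathlib

open Finset

noncomputable section

/-- Total setup time of machine `i` processing the job list `l`:
the initial setup for the first job plus the setup times over consecutive pairs
(`0` if the list is empty). -/
def totalSetup {M N : Type*} (setup0 : M → N → ℝ) (setup : M → N → N → ℝ)
    (i : M) (l : List N) : ℝ :=
  match l with
  | [] => 0
  | k :: rest => setup0 i k + (List.zipWith (setup i) (k :: rest) rest).sum

/-- A schedule assigns to each machine a finite sequence of jobs without repetition,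
such that every job appears in exactly one machine's sequence. -/
structure Schedule (M N : Type*) where
  seq : M → List N
  nodup : ∀ i, (seq i).Nodup
  cover : ∀ j : N, ∃! i : M, j ∈ seq i

variable {M N : Type*}

/-- Completion time of machine `i` in schedule `sc` under scenario `p`. -/
def complTime (setup0 : M → N → ℝ) (setup : M → N → N → ℝ)
    (sc : Schedule M N) (p : M → N → ℝ) (i : M) : ℝ :=
  totalSetup setup0 setup i (sc.seq i) + ((sc.seq i).map (p i)).sum

/-- Makespan of schedule `sc` under scenario `p`: max machine completion time. -/
def makespan [Fintype M] [Nonempty M] (setup0 : M → N → ℝ) (setup : M → N → N → ℝ)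
    (sc : Schedule M N) (p : M → N → ℝ) : ℝ :=
  Finset.univ.sup' Finset.univ_nonempty (complTime setup0 setup sc p)

/-- Optimal makespan under scenario `p`: minimum over all schedules. -/
def optMakespan [Fintype M] [Nonempty M] (setup0 : M → N → ℝ) (setup : M → N → N → ℝ)
    (p : M → N → ℝ) : ℝ :=
  ⨅ sc : Schedule M N, makespan setup0 setup sc p

/-- The scenario set `S`: all processing-time matrices between the bounds. -/
def ScenSet (lb ub : M → N → ℝ) : Set (M → N → ℝ) :=
  {p | ∀ i j, lb i j ≤ p i j ∧ p i j ≤ ub i j}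

/-- Regret of schedule `sc` under scenario `p`. -/
def regret [Fintype M] [Nonempty M] (setup0 : M → N → ℝ) (setup : M → N → N → ℝ)
    (sc : Schedule M N) (p : M → N → ℝ) : ℝ :=
  makespan setup0 setup sc p - optMakespan setup0 setup p

/-- Maximum regret of schedule `sc` over the scenario set. -/
def maxRegret [Fintype M] [Nonempty M] (setup0 : M → N → ℝ) (setup : M → N → N → ℝ)
    (lb ub : M → N → ℝ) (sc : Schedule M N) : ℝ :=
  ⨆ p : ScenSet lb ub, regret setup0 setup sc p.1

/-- The extreme scenario of schedule `sc` for machine `f`: upper bounds on jobs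
assigned to machine `f`, lower bounds elsewhere. -/
def extremeScen [DecidableEq N] (lb ub : M → N → ℝ) (sc : Schedule M N) (f : M) :
    M → N → ℝ :=
  fun i j => if j ∈ sc.seq f then ub i j else lb i j

/-- If machine `f` is critical for schedule `sc` under scenario `p0 ∈ S`,
then `f` is also critical for `sc` under the extreme scenario `s^f` of `sc` for `f`. -/
theorem critical_under_extreme_scenario [Fintype M] [Nonempty M] [DecidableEq N]
    (setup0 : M → N → ℝ) (setup : M → N → N → ℝ) (lb ub : M → N → ℝ)
    (sc : Schedule M N) (p0 : M → N → ℝ) (hp0 : p0 ∈ ScenSet lb ub)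
    (f : M) (hf : complTime setup0 setup sc p0 f = makespan setup0 setup sc p0) :
    complTime setup0 setup sc (extremeScen lb ub sc f) f =
      makespan setup0 setup sc (extremeScen lb ub sc f) := by
  apply le_antisymm
  · exact Finset.le_sup' (complTime setup0 setup sc (extremeScen lb ub sc f)) (Finset.mem_univ f)
  · refine Finset.sup'_le _ _ fun i _ => ?_
    by_cases hif : i = f
    · rw [hif]
    · have h1 : complTime setup0 setup sc (extremeScen lb ub sc f) i ≤
          complTime setup0 setup sc p0 i := by
        unfold complTime
        gcongr
        refine List.sum_le_sum fun j hj => ?_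
        have hjf : j ∉ sc.seq f := fun h => hif ((sc.cover j).unique hj h)
        simp only [extremeScen, if_neg hjf]
        exact (hp0 i j).1
      have h2 : complTime setup0 setup sc p0 i ≤ complTime setup0 setup sc p0 f := by
        rw [hf]
        exact Finset.le_sup' (complTime setup0 setup sc p0) (Finset.mem_univ i)
      have h3 : complTime setup0 setup sc p0 f ≤
          complTime setup0 setup sc (extremeScen lb ub sc f) f := by
        unfold complTime
        gcongr
        refine List.sum_le_sum fun j hj => ?_
        simp only [extremeScen, if_pos hj]
        exact (hp0 f j).2
      exact h1.trans (h2.trans h3)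

end
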